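/- Let E be an exact category with enough projectives and P a projective cover of E. Then P has generalised weak dependent products if and only if, for every object U of P, the slice category P/U (a projective cover of E/U) has generalised weak simple products. -/

import Mathlib

open CategoryTheory Limits

namespace ExComp

universe v u

variable {E : Type u} [Category.{v} E]

/-- A regular epimorphism, as a property of a morphism. -/
def RegEpi {A B : E} (f : A ⟶ B) : Prop := Nonempty (RegularEpi f)

/-- An object is (regular) projective if its covariant hom functor sends regular
epimorphisms to surjections. -/
def RegProjective (X : E) : Prop :=
  ∀ ⦃A B : E⦄ (e : A ⟶ B), RegEpi e → ∀ f : X ⟶ B, ∃ g : X ⟶ A, g ≫ e = f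

/-- `E` has enough projectives: every object admits a regular epimorphism from a
projective object. -/
def EnoughRegProjectives (E : Type u) [Category.{v} E] : Prop :=
  ∀ A : E, ∃ (X : E) (p : X ⟶ A), RegProjective X ∧ RegEpi p

/-- An internal equivalence relation: a jointly monic, reflexive, symmetric and
transitive pair of parallel arrows. -/
structure IsEquivRelPair {R X : E} (r₁ r₂ : R ⟶ X) : Prop where
  jointlyMono : ∀ ⦃T : E⦄ (h k : T ⟶ R), h ≫ r₁ = k ≫ r₁ → h ≫ r₂ = k ≫ r₂ → h = k
  refl : ∃ d : X ⟶ R, d ≫ r₁ = 𝟙 X ∧ d ≫ r₂ = 𝟙 X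
  symm : ∃ s : R ⟶ R, s ≫ r₁ = r₂ ∧ s ≫ r₂ = r₁
  trans : ∀ ⦃T : E⦄ (p q : T ⟶ R), p ≫ r₂ = q ≫ r₁ →
    ∃ t : T ⟶ R, t ≫ r₁ = p ≫ r₁ ∧ t ≫ r₂ = q ≫ r₂

/-- An exact category: a finitely complete category where every morphism factors as a
regular epi followed by a mono, regular epis are stable under pullback, and every
internal equivalence relation is effective (it is the kernel pair of the coequaliser
it admits). -/
structure IsExact (E : Type u) [Category.{v} E] [HasFiniteLimits E] : Prop where
  factor : ∀ ⦃A B : E⦄ (f : A ⟶ B), ∃ (I : E) (e : A ⟶ I) (m : I ⟶ B),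
    RegEpi e ∧ Mono m ∧ e ≫ m = f
  stable : ∀ ⦃A B C : E⦄ (f : A ⟶ B) (g : C ⟶ B), RegEpi f → RegEpi (pullback.snd f g)
  effective : ∀ ⦃R X : E⦄ (r₁ r₂ : R ⟶ X), IsEquivRelPair r₁ r₂ →
    ∃ (Q : E) (q : X ⟶ Q) (w : r₁ ≫ q = r₂ ≫ q),
      Nonempty (IsColimit (Cofork.ofπ q w)) ∧ IsPullback r₁ r₂ q q

/-- A projective cover of `E`: a (full sub)collection of objects, each projective,
such that every object of `E` admits a regular epimorphism from one of them. -/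
def IsProjectiveCover (P : Set E) : Prop :=
  (∀ X ∈ P, RegProjective X) ∧ ∀ A : E, ∃ X ∈ P, ∃ p : X ⟶ A, RegEpi p

section FinLim
variable [HasFiniteLimits E]

/-- `X` is internally projective: every arrow `T ⨯ X ⟶ B` lifts along a regular epi
`A ↠ B` after passing to a regular epi `U ↠ T`. -/
def InternallyProjective (X : E) : Prop :=
  ∀ ⦃T A B : E⦄ (e : A ⟶ B), RegEpi e → ∀ f : T ⨯ X ⟶ B,
    ∃ (U : E) (u : U ⟶ T) (g : U ⨯ X ⟶ A), RegEpi u ∧ g ≫ e = prod.map u (𝟙 X) ≫ f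

/-- Cartesian closure, as a property: for every object `X` the functor `(−) ⨯ X` has a
right adjoint. -/
def CartesianClosedP (E : Type u) [Category.{v} E] [HasFiniteLimits E] : Prop :=
  ∀ X : E, (prod.functor.flip.obj X).IsLeftAdjoint

/-- Local cartesian closure, as a property: every slice is cartesian closed. -/
def LocallyCartesianClosedP (E : Type u) [Category.{v} E] [HasFiniteLimits E] : Prop :=
  ∀ (I : E) (F : Over I), ((prod.functor (C := Over I)).flip.obj F).IsLeftAdjoint

end FinLim

/-! ## Weak products and weak simple products -/

/-- A weak product in `P` of `X` and `Y`: a span through which every span in `P`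
factors (not necessarily uniquely). -/
structure IsWeakProduct (P : Set E) {X Y V : E} (p : V ⟶ X) (q : V ⟶ Y) : Prop where
  mem : V ∈ P
  lift : ∀ ⦃V' : E⦄, V' ∈ P → ∀ (p' : V' ⟶ X) (q' : V' ⟶ Y),
    ∃ h : V' ⟶ V, h ≫ p = p' ∧ h ≫ q = q'

/-- An arrow out of a weak product is determined by projections if it coequalises
every pair of arrows (from an object of `P`) coequalised by both projections. -/
def DeterminedByProjections (P : Set E) {V X Y Z : E} (p : V ⟶ X) (q : V ⟶ Y)
    (f : V ⟶ Z) : Prop :=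
  ∀ ⦃V' : E⦄, V' ∈ P → ∀ (h k : V' ⟶ V), h ≫ p = k ≫ p → h ≫ q = k ≫ q → h ≫ f = k ≫ f

/-- A candidate diagram for a weak simple product of a span `J ←f Y →g X`. -/
structure WSPCone (P : Set E) {J Y X : E} (f : Y ⟶ J) (g : Y ⟶ X)
    (W V : E) (w : W ⟶ J) (p : V ⟶ W) (q : V ⟶ X) (e : V ⟶ Y) : Prop where
  memW : W ∈ P
  wp : IsWeakProduct P p q
  det : DeterminedByProjections P p q e
  comm₁ : p ≫ w = e ≫ f
  comm₂ : q = e ≫ g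

/-- A weak simple product: a weakly terminal candidate diagram. -/
structure IsWeakSimpleProduct (P : Set E) {J Y X : E} (f : Y ⟶ J) (g : Y ⟶ X)
    (W V : E) (w : W ⟶ J) (p : V ⟶ W) (q : V ⟶ X) (e : V ⟶ Y) : Prop where
  cone : WSPCone P f g W V w p q e
  lift : ∀ ⦃W' V' : E⦄ (w' : W' ⟶ J) (p' : V' ⟶ W') (q' : V' ⟶ X) (e' : V' ⟶ Y),
    WSPCone P f g W' V' w' p' q' e' →
    ∃ (α : W' ⟶ W) (β : V' ⟶ V),
      α ≫ w = w' ∧ β ≫ p = p' ≫ α ∧ β ≫ q = q' ∧ β ≫ e = e'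

/-- `P` has weak simple products. -/
def HasWeakSimpleProducts (P : Set E) : Prop :=
  ∀ ⦃J Y X : E⦄, J ∈ P → Y ∈ P → X ∈ P → ∀ (f : Y ⟶ J) (g : Y ⟶ X),
    ∃ (W V : E) (w : W ⟶ J) (p : V ⟶ W) (q : V ⟶ X) (e : V ⟶ Y),
      IsWeakSimpleProduct P f g W V w p q e

/-! ## Pseudo simple products -/

/-- A candidate diagram for a pseudo simple product (no determinacy requirement). -/
structure PSPCone (P : Set E) {J Y X : E} (f : Y ⟶ J) (g : Y ⟶ X)
    (W V : E) (w : W ⟶ J) (p : V ⟶ W) (q : V ⟶ X) (e : V ⟶ Y) : Prop where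
  memW : W ∈ P
  wp : IsWeakProduct P p q
  comm₁ : p ≫ w = e ≫ f
  comm₂ : q = e ≫ g

/-- A pseudo simple product: a weakly terminal candidate diagram. -/
structure IsPseudoSimpleProduct (P : Set E) {J Y X : E} (f : Y ⟶ J) (g : Y ⟶ X)
    (W V : E) (w : W ⟶ J) (p : V ⟶ W) (q : V ⟶ X) (e : V ⟶ Y) : Prop where
  cone : PSPCone P f g W V w p q e
  lift : ∀ ⦃W' V' : E⦄ (w' : W' ⟶ J) (p' : V' ⟶ W') (q' : V' ⟶ X) (e' : V' ⟶ Y),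
    PSPCone P f g W' V' w' p' q' e' →
    ∃ (α : W' ⟶ W) (β : V' ⟶ V),
      α ≫ w = w' ∧ β ≫ p = p' ≫ α ∧ β ≫ q = q' ∧ β ≫ e = e'

/-- `P` has pseudo simple products. -/
def HasPseudoSimpleProducts (P : Set E) : Prop :=
  ∀ ⦃J Y X : E⦄, J ∈ P → Y ∈ P → X ∈ P → ∀ (f : Y ⟶ J) (g : Y ⟶ X),
    ∃ (W V : E) (w : W ⟶ J) (p : V ⟶ W) (q : V ⟶ X) (e : V ⟶ Y),
      IsPseudoSimpleProduct P f g W V w p q e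

/-! ## Weak exponentials -/

/-- A candidate diagram for a weak exponential of `X` and `Y`. -/
structure WExpCone (P : Set E) {X Y : E} (W V : E) (p : V ⟶ W) (q : V ⟶ X)
    (e : V ⟶ Y) : Prop where
  memW : W ∈ P
  wp : IsWeakProduct P p q
  det : DeterminedByProjections P p q e

/-- A weak exponential of `X` and `Y` in `P`. -/
structure IsWeakExponential (P : Set E) {X Y : E} (W V : E) (p : V ⟶ W) (q : V ⟶ X)
    (e : V ⟶ Y) : Prop where
  cone : WExpCone P W V p q e
  lift : ∀ ⦃W' V' : E⦄ (p' : V' ⟶ W') (q' : V' ⟶ X) (e' : V' ⟶ Y),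
    WExpCone P W' V' p' q' e' →
    ∃ (α : W' ⟶ W) (β : V' ⟶ V), β ≫ p = p' ≫ α ∧ β ≫ q = q' ∧ β ≫ e = e'

/-- `P` has weak exponentials. -/
def HasWeakExponentials (P : Set E) : Prop :=
  ∀ ⦃X Y : E⦄, X ∈ P → Y ∈ P →
    ∃ (W V : E) (p : V ⟶ W) (q : V ⟶ X) (e : V ⟶ Y), IsWeakExponential P W V p q e

/-- A quasi exponential of `X` and `B`: the weak universal property of an exponential
restricted to projective sources. -/
def IsQuasiExponential [HasFiniteLimits E] (P : Set E) (X : E) {B : E} (W : E)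
    (e : W ⨯ X ⟶ B) : Prop :=
  ∀ ⦃Z : E⦄, Z ∈ P → ∀ f : Z ⨯ X ⟶ B, ∃ g : Z ⟶ W, prod.map g (𝟙 X) ≫ e = f

section FinLim2
variable [HasFiniteLimits E]

/-! ## Pseudo equivalence relations, equalities and generalised weak (simple) products -/

/-- A pseudo equivalence relation: a pair of parallel arrows whose image in `E` is an
equivalence relation. -/
def IsPseudoEquivRel {Y1 Y0 : E} (y₁ y₂ : Y1 ⟶ Y0) : Prop :=
  ∃ (R : E) (e : Y1 ⟶ R) (m : R ⟶ Y0 ⨯ Y0), RegEpi e ∧ Mono m ∧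
    e ≫ m = prod.lift y₁ y₂ ∧ IsEquivRelPair (m ≫ prod.fst) (m ≫ prod.snd)

/-- An equality for a weak limit, relative to the comparison arrow `c : V0 ⟶ L` into
the actual limit: a pseudo equivalence relation `v₁, v₂ : V1 ⇉ V0` in `P` such that
`c` is a coequaliser of `v₁, v₂` and `V1` regularly covers the kernel pair of `c`. -/
structure IsEqualityFor (P : Set E) {V1 V0 L : E} (c : V0 ⟶ L) (v₁ v₂ : V1 ⟶ V0) :
    Prop where
  mem : V1 ∈ P
  per : IsPseudoEquivRel v₁ v₂
  w : v₁ ≫ c = v₂ ≫ c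
  coeq : Nonempty (IsColimit (Cofork.ofπ c w))
  cover : RegEpi (pullback.lift v₁ v₂ w)

/-- An arrow `e : V ⟶ Z0` out of a weak product with projections `p, q` preserves
projections with respect to a pseudo equivalence relation `z₁, z₂ : Z1 ⇉ Z0` if for
any equality `v₁, v₂ : V1 ⇉ V` for the weak product there is `t : V1 ⟶ Z1` with
`t ≫ zᵢ = vᵢ ≫ e`. -/
def PreservesProjWP (P : Set E) {V X Y Z1 Z0 : E} (p : V ⟶ X) (q : V ⟶ Y)
    (z₁ z₂ : Z1 ⟶ Z0) (e : V ⟶ Z0) : Prop :=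
  ∀ ⦃V1 : E⦄ (v₁ v₂ : V1 ⟶ V), IsEqualityFor P (prod.lift p q) v₁ v₂ →
    ∃ t : V1 ⟶ Z1, t ≫ z₁ = v₁ ≫ e ∧ t ≫ z₂ = v₂ ≫ e

/-- A candidate diagram for a generalised weak simple product of `f` and `g` with
respect to the pseudo equivalence relation `y₁, y₂`. -/
structure GWSPCone (P : Set E) {Y1 Y0 J X : E} (y₁ y₂ : Y1 ⟶ Y0) (f : Y0 ⟶ J)
    (g : Y0 ⟶ X) (W V : E) (w : W ⟶ J) (p : V ⟶ W) (q : V ⟶ X) (e : V ⟶ Y0) :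
    Prop where
  memW : W ∈ P
  wp : IsWeakProduct P p q
  pres : PreservesProjWP P p q y₁ y₂ e
  comm₁ : p ≫ w = e ≫ f
  comm₂ : q = e ≫ g

/-- A generalised weak simple product: a weakly terminal candidate diagram. -/
structure IsGWSP (P : Set E) {Y1 Y0 J X : E} (y₁ y₂ : Y1 ⟶ Y0) (f : Y0 ⟶ J)
    (g : Y0 ⟶ X) (W V : E) (w : W ⟶ J) (p : V ⟶ W) (q : V ⟶ X) (e : V ⟶ Y0) :
    Prop where
  cone : GWSPCone P y₁ y₂ f g W V w p q e
  lift : ∀ ⦃W' V' : E⦄ (w' : W' ⟶ J) (p' : V' ⟶ W') (q' : V' ⟶ X) (e' : V' ⟶ Y0),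
    GWSPCone P y₁ y₂ f g W' V' w' p' q' e' →
    ∃ (α : W' ⟶ W) (β : V' ⟶ V),
      α ≫ w = w' ∧ β ≫ p = p' ≫ α ∧ β ≫ q = q' ∧ β ≫ e = e'

/-- `P` has generalised weak simple products. -/
def HasGWSP (P : Set E) : Prop :=
  ∀ ⦃Y1 Y0 J X : E⦄, Y1 ∈ P → Y0 ∈ P → J ∈ P → X ∈ P →
    ∀ (y₁ y₂ : Y1 ⟶ Y0), IsPseudoEquivRel y₁ y₂ →
    ∀ (f : Y0 ⟶ J) (g : Y0 ⟶ X), y₁ ≫ f = y₂ ≫ f → y₁ ≫ g = y₂ ≫ g →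
    ∃ (W V : E) (w : W ⟶ J) (p : V ⟶ W) (q : V ⟶ X) (e : V ⟶ Y0),
      IsGWSP P y₁ y₂ f g W V w p q e

/-- A candidate diagram for a generalised weak exponential of `X` and `y₁, y₂`. -/
structure GWExpCone (P : Set E) {X Y1 Y0 : E} (y₁ y₂ : Y1 ⟶ Y0)
    (W V : E) (p : V ⟶ W) (q : V ⟶ X) (e : V ⟶ Y0) : Prop where
  memW : W ∈ P
  wp : IsWeakProduct P p q
  pres : PreservesProjWP P p q y₁ y₂ e

/-- A generalised weak exponential of `X` and a pseudo equivalence relation. -/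
structure IsGWExp (P : Set E) {X Y1 Y0 : E} (y₁ y₂ : Y1 ⟶ Y0)
    (W V : E) (p : V ⟶ W) (q : V ⟶ X) (e : V ⟶ Y0) : Prop where
  cone : GWExpCone P y₁ y₂ W V p q e
  lift : ∀ ⦃W' V' : E⦄ (p' : V' ⟶ W') (q' : V' ⟶ X) (e' : V' ⟶ Y0),
    GWExpCone P y₁ y₂ W' V' p' q' e' →
    ∃ (α : W' ⟶ W) (β : V' ⟶ V), β ≫ p = p' ≫ α ∧ β ≫ q = q' ∧ β ≫ e = e'

/-! ## Weak pullbacks and generalised weak dependent products -/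

/-- A weak pullback in `P` of the cospan `X →f J ←w W`. -/
structure IsWeakPullback (P : Set E) {X J W V : E} (f : X ⟶ J) (w : W ⟶ J)
    (a : V ⟶ X) (b : V ⟶ W) : Prop where
  mem : V ∈ P
  comm : a ≫ f = b ≫ w
  lift : ∀ ⦃V' : E⦄, V' ∈ P → ∀ (a' : V' ⟶ X) (b' : V' ⟶ W), a' ≫ f = b' ≫ w →
    ∃ h : V' ⟶ V, h ≫ a = a' ∧ h ≫ b = b'

/-- Preservation of projections for an arrow out of a weak pullback. -/
def PreservesProjWPB (P : Set E) {V X J W Z1 Z0 : E} (f : X ⟶ J) (w : W ⟶ J)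
    (a : V ⟶ X) (b : V ⟶ W) (h : a ≫ f = b ≫ w) (z₁ z₂ : Z1 ⟶ Z0) (e : V ⟶ Z0) :
    Prop :=
  ∀ ⦃V1 : E⦄ (v₁ v₂ : V1 ⟶ V), IsEqualityFor P (pullback.lift a b h) v₁ v₂ →
    ∃ t : V1 ⟶ Z1, t ≫ z₁ = v₁ ≫ e ∧ t ≫ z₂ = v₂ ≫ e

/-- A candidate diagram for a generalised weak dependent product of `g : Y0 ⟶ X`
along `f : X ⟶ J` with respect to `y₁, y₂`. -/
structure GWDPCone (P : Set E) {Y1 Y0 X J : E} (y₁ y₂ : Y1 ⟶ Y0) (g : Y0 ⟶ X)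
    (f : X ⟶ J) (W V : E) (w : W ⟶ J) (a : V ⟶ X) (b : V ⟶ W) (e : V ⟶ Y0) :
    Prop where
  memW : W ∈ P
  comm : a ≫ f = b ≫ w
  wpb : IsWeakPullback P f w a b
  overX : e ≫ g = a
  pres : PreservesProjWPB P f w a b comm y₁ y₂ e

/-- A generalised weak dependent product: a weakly terminal candidate diagram. -/
structure IsGWDP (P : Set E) {Y1 Y0 X J : E} (y₁ y₂ : Y1 ⟶ Y0) (g : Y0 ⟶ X)
    (f : X ⟶ J) (W V : E) (w : W ⟶ J) (a : V ⟶ X) (b : V ⟶ W) (e : V ⟶ Y0) :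
    Prop where
  cone : GWDPCone P y₁ y₂ g f W V w a b e
  lift : ∀ ⦃W' V' : E⦄ (w' : W' ⟶ J) (a' : V' ⟶ X) (b' : V' ⟶ W') (e' : V' ⟶ Y0),
    GWDPCone P y₁ y₂ g f W' V' w' a' b' e' →
    ∃ (α : W' ⟶ W) (β : V' ⟶ V),
      α ≫ w = w' ∧ β ≫ a = a' ∧ β ≫ b = b' ≫ α ∧ β ≫ e = e'

/-- `P` has generalised weak dependent products (i.e. `P` is weakly locally cartesian
closed). -/
def HasGWDP (P : Set E) : Prop :=
  ∀ ⦃Y1 Y0 X J : E⦄, Y1 ∈ P → Y0 ∈ P → X ∈ P → J ∈ P →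
    ∀ (y₁ y₂ : Y1 ⟶ Y0), IsPseudoEquivRel y₁ y₂ →
    ∀ (g : Y0 ⟶ X) (f : X ⟶ J), y₁ ≫ g = y₂ ≫ g →
    ∃ (W V : E) (w : W ⟶ J) (a : V ⟶ X) (b : V ⟶ W) (e : V ⟶ Y0),
      IsGWDP P y₁ y₂ g f W V w a b e

/-! ## The functor `w_X` on subobjects induced by weak simple products -/

/-- The adjunction property of the weak-simple-product operation `w_X` on subobjects:
for every subobject `a : A ↪ J ⨯ X`, every `P`-cover `Y ↠ A`, every weak simple
product `W → J` of the induced span and every image factorisation `W ↠ I ↪ J` of it,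
the subobject `I ↪ J` is a value at `a` of a right adjoint to
`(−) ⨯ X : Sub(J) → Sub(J ⨯ X)`. -/
def WAdj (P : Set E) (J X : E) : Prop :=
  ∀ ⦃A : E⦄ (a : A ⟶ J ⨯ X), Mono a →
  ∀ ⦃Y : E⦄, Y ∈ P → ∀ (c : Y ⟶ A), RegEpi c →
  ∀ ⦃W V : E⦄ (w : W ⟶ J) (p : V ⟶ W) (q : V ⟶ X) (e : V ⟶ Y),
    IsWeakSimpleProduct P (c ≫ a ≫ prod.fst) (c ≫ a ≫ prod.snd) W V w p q e →
  ∀ ⦃I : E⦄ (ew : W ⟶ I) (m : I ⟶ J), RegEpi ew → Mono m → ew ≫ m = w →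
  ∀ ⦃B : E⦄ (b : B ⟶ J), Mono b →
    ((∃ t : B ⨯ X ⟶ A, t ≫ a = prod.map b (𝟙 X)) ↔ ∃ s : B ⟶ I, s ≫ m = b)

/-! ## Weak dependent products (à la Carboni–Rosolini) -/

/-- `P` has weak dependent products: for `f : X ⟶ J` and `g : Y ⟶ X` in `P` there are
`w : W ⟶ J` in `P` and a surjection `Hom_{P/J}(h, w) → Hom_{P/X}(f*(h), g)` natural
in `h ∈ P/J`. -/
def HasWeakDependentProducts (P : Set E) : Prop :=
  ∀ ⦃X J Y : E⦄, X ∈ P → J ∈ P → Y ∈ P → ∀ (f : X ⟶ J) (g : Y ⟶ X),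
    ∃ (W : E) (_ : W ∈ P) (w : W ⟶ J)
      (ε : ∀ ⦃T : E⦄, T ∈ P → ∀ (h : T ⟶ J) (k : T ⟶ W), k ≫ w = h →
        (pullback h f ⟶ Y)),
      (∀ ⦃T : E⦄ (hT : T ∈ P) (h : T ⟶ J) (k : T ⟶ W) (hk : k ≫ w = h),
         ε hT h k hk ≫ g = pullback.snd h f) ∧
      (∀ ⦃T : E⦄ (hT : T ∈ P) (h : T ⟶ J) (d : pullback h f ⟶ Y),
         d ≫ g = pullback.snd h f → ∃ (k : T ⟶ W) (hk : k ≫ w = h), ε hT h k hk = d) ∧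
      (∀ ⦃T' T : E⦄ (hT' : T' ∈ P) (hT : T ∈ P) (u : T' ⟶ T) (h : T ⟶ J) (k : T ⟶ W)
         (hk : k ≫ w = h),
         ε hT' (u ≫ h) (u ≫ k) (by rw [Category.assoc, hk]) =
           pullback.map (u ≫ h) f h f u (𝟙 X) (𝟙 J) (by simp) (by simp) ≫ ε hT h k hk)

end FinLim2

section Aux

attribute [local simp] pullback.lift_fst pullback.lift_snd pullback.lift_fst_assoc pullback.lift_snd_assoc
  prod.lift_fst prod.lift_snd prod.lift_fst_assoc prod.lift_snd_assoc

def PSurj (P : Set E) {A L : E} (c : A ⟶ L) : Prop :=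
  ∀ ⦃T : E⦄, T ∈ P → ∀ t : T ⟶ L, ∃ h : T ⟶ A, h ≫ c = t

def FactorP (E : Type u) [Category.{v} E] : Prop :=
  ∀ ⦃A B : E⦄ (f : A ⟶ B), ∃ (I : E) (e : A ⟶ I) (m : I ⟶ B),
    RegEpi e ∧ Mono m ∧ e ≫ m = f

theorem RegEpi.epi' {A B : E} {f : A ⟶ B} (h : RegEpi f) : Epi f := by
  obtain ⟨h⟩ := h
  exact h.epi

theorem RegEpi.pSurj {P : Set E} (hP : IsProjectiveCover P) {A L : E} {c : A ⟶ L}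
    (h : RegEpi c) : PSurj P c := fun _ hT t => hP.1 _ hT c h t

theorem hom_ext_P {P : Set E} (hP : IsProjectiveCover P) {A B : E} {a b : A ⟶ B}
    (h : ∀ ⦃T : E⦄, T ∈ P → ∀ t : T ⟶ A, t ≫ a = t ≫ b) : a = b := by
  obtain ⟨T, hT, p, hp⟩ := hP.2 A
  have := hp.epi'
  exact (cancel_epi p).1 (h hT p)

theorem RegEpi.descend {P : Set E} (hP : IsProjectiveCover P) {A L B : E} {c : A ⟶ L}
    (hc : RegEpi c) (s : A ⟶ B)
    (h : ∀ ⦃T : E⦄, T ∈ P → ∀ v₁ v₂ : T ⟶ A, v₁ ≫ c = v₂ ≫ c → v₁ ≫ s = v₂ ≫ s) :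
    ∃ d : L ⟶ B, c ≫ d = s := by
  obtain ⟨r⟩ := hc
  have hs : r.left ≫ s = r.right ≫ s := by
    refine hom_ext_P hP fun T hT t => ?_
    have := h hT (t ≫ r.left) (t ≫ r.right) (by simp [r.w])
    simpa using this
  exact ⟨_, (r.desc' s hs).2⟩

theorem PSurj.regEpi {P : Set E} (hF : FactorP E) (hP : IsProjectiveCover P) {A L : E}
    {c : A ⟶ L} (h : PSurj P c) : RegEpi c := by
  obtain ⟨I, e, m, he, hm, rfl⟩ := hF c
  obtain ⟨T, hT, p, hp⟩ := hP.2 L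
  obtain ⟨k, hk⟩ := h hT p
  obtain ⟨d, hd⟩ := hp.descend hP (k ≫ e) (fun T hT v₁ v₂ hv => by
    rw [← cancel_mono m]
    simpa [hk] using hv)
  have := hp.epi'
  have h1 : d ≫ m = 𝟙 L := by
    rw [← cancel_epi p, ← Category.assoc, hd]; simpa using hk
  have h2 : m ≫ d = 𝟙 I := by
    rw [← cancel_mono m]; simp [h1]
  obtain ⟨r⟩ := he
  let i : I ≅ L := ⟨m, d, h2, h1⟩
  exact ⟨r.ofArrowIso (Arrow.isoMk (f := Arrow.mk e) (g := Arrow.mk (e ≫ m)) (Iso.refl _) i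
    (by simp [i]))⟩

theorem PSurj.descend {P : Set E} (hF : FactorP E) (hP : IsProjectiveCover P)
    {A L B : E} {c : A ⟶ L}
    (hc : PSurj P c) (s : A ⟶ B)
    (h : ∀ ⦃T : E⦄, T ∈ P → ∀ v₁ v₂ : T ⟶ A, v₁ ≫ c = v₂ ≫ c → v₁ ≫ s = v₂ ≫ s) :
    ∃ d : L ⟶ B, c ≫ d = s := (hc.regEpi hF hP).descend hP s h

variable [HasFiniteLimits E]

theorem equivRel_kernel {A L : E} (c : A ⟶ L) :
    IsEquivRelPair (pullback.fst c c) (pullback.snd c c) where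
  jointlyMono := fun _ _ _ h1 h2 => pullback.hom_ext h1 h2
  refl := ⟨pullback.lift (𝟙 _) (𝟙 _) rfl, by simp, by simp⟩
  symm := ⟨pullback.lift (pullback.snd _ _) (pullback.fst _ _) pullback.condition.symm,
    by simp, by simp⟩
  trans := fun T p q h => ⟨pullback.lift (p ≫ pullback.fst _ _) (q ≫ pullback.snd _ _) (by
    rw [Category.assoc, pullback.condition, ← Category.assoc, h, Category.assoc,
      pullback.condition, Category.assoc]), by simp, by simp⟩

/-- covering a kernel pair gives a pseudo equivalence relation -/
theorem per_of_cover {A L N : E} (c : A ⟶ L) (n : N ⟶ pullback c c) (hn : RegEpi n) :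
    IsPseudoEquivRel (n ≫ pullback.fst c c) (n ≫ pullback.snd c c) := by
  refine ⟨pullback c c, n, prod.lift (pullback.fst c c) (pullback.snd c c), hn, ?_, ?_, ?_⟩
  · refine ⟨fun a b h => pullback.hom_ext ?_ ?_⟩
    · simpa using congrArg (· ≫ prod.fst) h
    · simpa using congrArg (· ≫ prod.snd) h
  · ext <;> simp
  · simpa using equivRel_kernel c

theorem exists_equality {P : Set E} (hP : IsProjectiveCover P) {A L : E} (c : A ⟶ L)
    (hc : RegEpi c) : ∃ (N : E) (v₁ v₂ : N ⟶ A), IsEqualityFor P c v₁ v₂ := by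
  obtain ⟨N, hN, n, hn⟩ := hP.2 (pullback c c)
  have hw : (n ≫ pullback.fst c c) ≫ c = (n ≫ pullback.snd c c) ≫ c := by
    simp [pullback.condition]
  refine ⟨N, n ≫ pullback.fst c c, n ≫ pullback.snd c c, hN, per_of_cover c n hn, hw, ?_, ?_⟩
  · have := hc.epi'
    have key : ∀ s : Cofork (n ≫ pullback.fst c c) (n ≫ pullback.snd c c),
        ∃ d : L ⟶ s.pt, c ≫ d = s.π := by
      intro s
      refine hc.descend hP _ fun T hT v₁ v₂ hv => ?_
      obtain ⟨k, hk⟩ := hn.pSurj hP hT (pullback.lift v₁ v₂ hv)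
      have := congrArg (k ≫ ·) s.condition
      simp only [← Category.assoc, hk] at this
      simpa using this
    choose d hd using key
    exact ⟨Cofork.IsColimit.mk _ d hd (fun s m hm => by
      rw [← cancel_epi c, hd]; exact hm)⟩
  · convert hn
    apply pullback.hom_ext <;> simp

/-- elementwise version of preservation of projections -/
def PresE (P : Set E) {V L Z1 Z0 : E} (c : V ⟶ L) (z₁ z₂ : Z1 ⟶ Z0) (e : V ⟶ Z0) : Prop :=
  ∀ ⦃T : E⦄, T ∈ P → ∀ v₁ v₂ : T ⟶ V, v₁ ≫ c = v₂ ≫ c →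
    ∃ t : T ⟶ Z1, t ≫ z₁ = v₁ ≫ e ∧ t ≫ z₂ = v₂ ≫ e

theorem presE_iff {P : Set E} (hP : IsProjectiveCover P) {V L Z1 Z0 : E} (c : V ⟶ L)
    (hc : RegEpi c) (z₁ z₂ : Z1 ⟶ Z0) (e : V ⟶ Z0) :
    (∀ ⦃V1 : E⦄ (v₁ v₂ : V1 ⟶ V), IsEqualityFor P c v₁ v₂ →
      ∃ t : V1 ⟶ Z1, t ≫ z₁ = v₁ ≫ e ∧ t ≫ z₂ = v₂ ≫ e) ↔ PresE P c z₁ z₂ e := by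
  constructor
  · intro h T hT v₁ v₂ hv
    obtain ⟨N, n₁, n₂, hn⟩ := exists_equality hP c hc
    obtain ⟨t, h1, h2⟩ := h n₁ n₂ hn
    obtain ⟨k, hk⟩ := hn.cover.pSurj hP hT (pullback.lift v₁ v₂ hv)
    have e1 : k ≫ n₁ = v₁ := by simpa using congrArg (· ≫ pullback.fst c c) hk
    have e2 : k ≫ n₂ = v₂ := by simpa using congrArg (· ≫ pullback.snd c c) hk
    exact ⟨k ≫ t, by simp [h1, ← e1], by simp [h2, ← e2]⟩
  · intro h V1 v₁ v₂ hv
    exact h hv.mem v₁ v₂ hv.w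

theorem wpb_regEpi {P : Set E} (hF : FactorP E) (hP : IsProjectiveCover P) {X J W V : E}
    {f : X ⟶ J} {w : W ⟶ J} {a : V ⟶ X} {b : V ⟶ W} (h : IsWeakPullback P f w a b)
    (hc : a ≫ f = b ≫ w) : RegEpi (pullback.lift a b hc) := by
  refine PSurj.regEpi hF hP fun T hT t => ?_
  obtain ⟨k, h1, h2⟩ := h.lift hT (t ≫ pullback.fst _ _) (t ≫ pullback.snd _ _)
    (by simp [pullback.condition])
  exact ⟨k, by apply pullback.hom_ext <;> simp [h1, h2]⟩

theorem wp_regEpi {P : Set E} (hF : FactorP E) (hP : IsProjectiveCover P) {X Y V : E}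
    {p : V ⟶ X} {q : V ⟶ Y} (h : IsWeakProduct P p q) : RegEpi (prod.lift p q) := by
  refine PSurj.regEpi hF hP fun T hT t => ?_
  obtain ⟨k, h1, h2⟩ := h.lift hT (t ≫ prod.fst) (t ≫ prod.snd)
  exact ⟨k, by apply Limits.prod.hom_ext <;> simp [h1, h2]⟩

/-- preservation in terms of two legs -/
def Pres2 (P : Set E) {V A B Z1 Z0 : E} (p : V ⟶ A) (q : V ⟶ B) (z₁ z₂ : Z1 ⟶ Z0)
    (e : V ⟶ Z0) : Prop :=
  ∀ ⦃T : E⦄, T ∈ P → ∀ v₁ v₂ : T ⟶ V, v₁ ≫ p = v₂ ≫ p → v₁ ≫ q = v₂ ≫ q →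
    ∃ t : T ⟶ Z1, t ≫ z₁ = v₁ ≫ e ∧ t ≫ z₂ = v₂ ≫ e

theorem presWP_iff {P : Set E} (hF : FactorP E) (hP : IsProjectiveCover P) {X Y V Z1 Z0 : E}
    {p : V ⟶ X} {q : V ⟶ Y} (h : IsWeakProduct P p q) (z₁ z₂ : Z1 ⟶ Z0) (e : V ⟶ Z0) :
    PreservesProjWP P p q z₁ z₂ e ↔ Pres2 P p q z₁ z₂ e := by
  refine (presE_iff hP _ (wp_regEpi hF hP h) z₁ z₂ e).trans ?_
  constructor
  · intro H T hT v₁ v₂ h1 h2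
    exact H hT v₁ v₂ (by simp [h1, h2])
  · intro H T hT v₁ v₂ hv
    exact H hT v₁ v₂ (by simpa using congrArg (· ≫ prod.fst) hv)
      (by simpa using congrArg (· ≫ prod.snd) hv)

theorem presWPB_iff {P : Set E} (hF : FactorP E) (hP : IsProjectiveCover P)
    {X J W V Z1 Z0 : E}
    {f : X ⟶ J} {w : W ⟶ J} {a : V ⟶ X} {b : V ⟶ W} (h : IsWeakPullback P f w a b)
    (hc : a ≫ f = b ≫ w) (z₁ z₂ : Z1 ⟶ Z0) (e : V ⟶ Z0) :
    PreservesProjWPB P f w a b hc z₁ z₂ e ↔ Pres2 P a b z₁ z₂ e := by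
  refine (presE_iff hP _ (wpb_regEpi hF hP h hc) z₁ z₂ e).trans ?_
  constructor
  · intro H T hT v₁ v₂ h1 h2
    exact H hT v₁ v₂ (by apply pullback.hom_ext <;> simp [h1, h2])
  · intro H T hT v₁ v₂ hv
    exact H hT v₁ v₂ (by simpa using congrArg (· ≫ pullback.fst _ _) hv)
      (by simpa using congrArg (· ≫ pullback.snd _ _) hv)

/-- quotients of pseudo equivalence relations -/
theorem per_quotient (hE : IsExact E) {P : Set E} (hP : IsProjectiveCover P) {Y1 Y0 : E}
    (y₁ y₂ : Y1 ⟶ Y0) (h : IsPseudoEquivRel y₁ y₂) :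
    ∃ (B : E) (π : Y0 ⟶ B), RegEpi π ∧ y₁ ≫ π = y₂ ≫ π ∧
      ∀ ⦃T : E⦄, T ∈ P → ∀ v₁ v₂ : T ⟶ Y0, v₁ ≫ π = v₂ ≫ π →
        ∃ t : T ⟶ Y1, t ≫ y₁ = v₁ ∧ t ≫ y₂ = v₂ := by
  obtain ⟨R, e, m, he, hm, hem, hR⟩ := h
  obtain ⟨Q, q, w, ⟨hq⟩, hpb⟩ := hE.effective _ _ hR
  have h1 : e ≫ m ≫ prod.fst = y₁ := by simp [← Category.assoc, hem]
  have h2 : e ≫ m ≫ prod.snd = y₂ := by simp [← Category.assoc, hem]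
  refine ⟨Q, q, ⟨⟨_, _, _, w, hq⟩⟩, ?_, ?_⟩
  · simpa [← h1, ← h2] using congrArg (e ≫ ·) w
  · intro T hT v₁ v₂ hv
    obtain ⟨t, ht⟩ := he.pSurj hP hT (hpb.lift v₁ v₂ hv)
    refine ⟨t, ?_, ?_⟩
    · rw [← h1, ← Category.assoc, ht, hpb.lift_fst]
    · rw [← h2, ← Category.assoc, ht, hpb.lift_snd]

/-- quasi dependent product of `h : B ⟶ K` along `k : K ⟶ J` -/
def QDP (P : Set E) {B K J : E} (h : B ⟶ K) (k : K ⟶ J) : Prop :=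
  ∃ (W : E) (_ : W ∈ P) (w : W ⟶ J) (s : pullback w k ⟶ B), s ≫ h = pullback.snd w k ∧
    ∀ ⦃W' : E⦄, W' ∈ P → ∀ (w' : W' ⟶ J) (s' : pullback w' k ⟶ B),
      s' ≫ h = pullback.snd w' k → ∃ α : W' ⟶ W, α ≫ w = w' ∧
        ∀ ⦃T : E⦄, T ∈ P → ∀ (z : T ⟶ pullback w' k) (z' : T ⟶ pullback w k),
          z' ≫ pullback.fst w k = z ≫ pullback.fst w' k ≫ α →
          z' ≫ pullback.snd w k = z ≫ pullback.snd w' k → z ≫ s' = z' ≫ s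

theorem quasiA (hF : FactorP E) {P : Set E} (hP : IsProjectiveCover P) (hG : HasGWDP P)
    {X J B : E} (hX : X ∈ P) (hJ : J ∈ P) (h : B ⟶ X) (f : X ⟶ J) : QDP P h f := by
  obtain ⟨Y0, hY0, π, hπ⟩ := hP.2 B
  obtain ⟨Y1, hY1, n, hn⟩ := hP.2 (pullback π π)
  obtain ⟨W, V, w, a, b, e, hD⟩ := hG hY1 hY0 hX hJ _ _ (per_of_cover π n hn) (π ≫ h) f
    (by simp [pullback.condition_assoc])
  have hpres := (presWPB_iff hF hP hD.cone.wpb hD.cone.comm _ _ _).1 hD.cone.pres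
  have hcomm := hD.cone.comm
  have hov := hD.cone.overX
  have hc : PSurj P (pullback.lift b a hcomm.symm) := by
    intro T hT t
    obtain ⟨l, h1, h2⟩ := hD.cone.wpb.lift hT (t ≫ pullback.snd _ _) (t ≫ pullback.fst _ _)
      (by simp [pullback.condition])
    exact ⟨l, by apply pullback.hom_ext <;> simp [h1, h2]⟩
  obtain ⟨s, hs⟩ := hc.descend hF hP (e ≫ π) (by
    intro T hT v₁ v₂ hv
    obtain ⟨t, h1, h2⟩ := hpres hT v₁ v₂
      (by simpa using congrArg (· ≫ pullback.snd _ _) hv)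
      (by simpa using congrArg (· ≫ pullback.fst _ _) hv)
    rw [← reassoc_of% h1, ← reassoc_of% h2, pullback.condition])
  have := (hc.regEpi hF hP).epi'
  refine ⟨W, hD.cone.memW, w, s, ?_, ?_⟩
  · rw [← cancel_epi (pullback.lift b a hcomm.symm), ← Category.assoc, hs]
    simpa using hov
  · intro W' hW' w' s' hs'
    obtain ⟨V', hV', c', hc'⟩ := hP.2 (pullback w' f)
    obtain ⟨e', he'⟩ := hπ.pSurj hP hV' (c' ≫ s')
    have hwpb : IsWeakPullback P f w' (c' ≫ pullback.snd _ _) (c' ≫ pullback.fst _ _) := by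
      refine ⟨hV', by simp [pullback.condition], ?_⟩
      intro T hT a' b' hab
      obtain ⟨l, hl⟩ := hc'.pSurj hP hT (pullback.lift b' a' hab.symm)
      exact ⟨l, by simp [← Category.assoc, hl], by simp [← Category.assoc, hl]⟩
    obtain ⟨α, β, h1, h2, h3, h4⟩ := hD.lift w' (c' ≫ pullback.snd _ _)
      (c' ≫ pullback.fst _ _) e' ⟨hW', hwpb.comm, hwpb, by
        rw [← Category.assoc, he', Category.assoc, hs'], by
        rw [presWPB_iff hF hP hwpb]
        intro T hT v₁ v₂ h1 h2
        have hv : v₁ ≫ c' = v₂ ≫ c' := by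
          apply pullback.hom_ext
          · simpa using h2
          · simpa using h1
        obtain ⟨t, ht⟩ := hn.pSurj hP hT (pullback.lift (v₁ ≫ e') (v₂ ≫ e') (by
          simp only [Category.assoc, he']
          rw [← Category.assoc, hv, Category.assoc]))
        exact ⟨t, by simp [← Category.assoc, ht], by simp [← Category.assoc, ht]⟩⟩
    refine ⟨α, h1, ?_⟩
    intro T hT z z' hz1 hz2
    obtain ⟨k, hk⟩ := hc'.pSurj hP hT z
    have e1 : z' = k ≫ β ≫ pullback.lift b a hcomm.symm := by
      apply pullback.hom_ext
      · simp [hz1, h3, ← hk]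
      · simp [hz2, h2, ← hk]
    rw [e1, ← hk, Category.assoc, ← he', ← h4]
    simp [hs]

set_option maxHeartbeats 1600000 in
theorem quasiB (hF : FactorP E) {P : Set E} (hP : IsProjectiveCover P) (hG : HasGWDP P)
    {K J B : E} (hJ : J ∈ P) (h : B ⟶ K) (k : K ⟶ J) : QDP P h k := by
  obtain ⟨Q, hQ, ρ, hρ⟩ := hP.2 K
  obtain ⟨W0, hW0, w0, s0, hs0, U0⟩ := quasiA hF hP hG hQ hJ (pullback.snd h ρ) (ρ ≫ k)
  have hs0' : s0 ≫ pullback.fst h ρ ≫ h = pullback.snd _ _ ≫ ρ := by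
    rw [pullback.condition, ← Category.assoc, hs0]
  obtain ⟨Q1, hQ1, n, hn⟩ := hP.2 (pullback ρ ρ)
  obtain ⟨X, hX, x, hx⟩ := hP.2 (pullback w0 (n ≫ pullback.fst ρ ρ ≫ ρ ≫ k))
  let u₁ : X ⟶ pullback w0 (ρ ≫ k) := pullback.lift (x ≫ pullback.fst _ _)
    (x ≫ pullback.snd _ _ ≫ n ≫ pullback.fst ρ ρ) (by simp [pullback.condition])
  let u₂ : X ⟶ pullback w0 (ρ ≫ k) := pullback.lift (x ≫ pullback.fst _ _)
    (x ≫ pullback.snd _ _ ≫ n ≫ pullback.snd ρ ρ) (by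
      simp [pullback.condition, pullback.condition_assoc])
  obtain ⟨W, hW, w1, s1, hs1, U1⟩ := quasiA hF hP hG hX hW0
    (equalizer.ι (u₁ ≫ s0 ≫ pullback.fst _ _) (u₂ ≫ s0 ≫ pullback.fst _ _))
    (x ≫ pullback.fst _ _)
  let r : pullback (w1 ≫ w0) (ρ ≫ k) ⟶ pullback w0 (ρ ≫ k) :=
    pullback.lift (pullback.fst _ _ ≫ w1) (pullback.snd _ _) (by simp [pullback.condition])
  let c : ∀ {A : E} (a : A ⟶ J), pullback a (ρ ≫ k) ⟶ pullback a k := fun a =>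
    pullback.lift (pullback.fst _ _) (pullback.snd _ _ ≫ ρ) (by simp [pullback.condition])
  have hc : PSurj P (c (w1 ≫ w0)) := by
    intro T hT t
    obtain ⟨j, hj⟩ := hρ.pSurj hP hT (t ≫ pullback.snd _ _)
    refine ⟨pullback.lift (t ≫ pullback.fst _ _) j ?_, ?_⟩
    · rw [← Category.assoc j, hj]; simp [pullback.condition]
    · apply pullback.hom_ext <;> simp [c, hj]
  obtain ⟨s, hs⟩ := hc.descend hF hP (r ≫ s0 ≫ pullback.fst _ _) (by
    intro T hT v₁ v₂ hv
    have hv1 : v₁ ≫ pullback.fst _ _ = v₂ ≫ pullback.fst _ _ := by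
      simpa [c] using congrArg (· ≫ pullback.fst _ _) hv
    have hv2 : v₁ ≫ pullback.snd _ _ ≫ ρ = v₂ ≫ pullback.snd _ _ ≫ ρ := by
      simpa [c] using congrArg (· ≫ pullback.snd _ _) hv
    obtain ⟨j, hj⟩ := hn.pSurj hP hT (pullback.lift (v₁ ≫ pullback.snd _ _)
      (v₂ ≫ pullback.snd _ _) (by simpa using hv2))
    have hj1 : j ≫ n ≫ pullback.fst ρ ρ = v₁ ≫ pullback.snd _ _ := by
      simp [← Category.assoc, hj]
    have hj2 : j ≫ n ≫ pullback.snd ρ ρ = v₂ ≫ pullback.snd _ _ := by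
      simp [← Category.assoc, hj]
    obtain ⟨l, hl⟩ := hx.pSurj hP hT (pullback.lift (v₁ ≫ pullback.fst _ _ ≫ w1) j (by
      have := congrArg (v₁ ≫ ·) (pullback.condition (f := w1 ≫ w0) (g := ρ ≫ k))
      rw [← Category.assoc n, ← Category.assoc j, hj1]
      simpa using this))
    have hl1 : l ≫ x ≫ pullback.fst _ _ = v₁ ≫ pullback.fst _ _ ≫ w1 := by
      simp [← Category.assoc, hl]
    have hl2 : l ≫ x ≫ pullback.snd _ _ = j := by
      simp [← Category.assoc, hl]
    have ho : pullback.lift (f := w1) (g := x ≫ pullback.fst _ _) (v₁ ≫ pullback.fst _ _) l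
        (by simp [hl1]) ≫ s1 ≫ equalizer.ι _ _ = l := by
      rw [hs1]; simp
    have e1 : v₁ ≫ r = l ≫ u₁ := by
      apply pullback.hom_ext
      · simp [r, u₁, hl1]
      · simp [r, u₁, reassoc_of% hl2, hj1]
    have e2 : v₂ ≫ r = l ≫ u₂ := by
      apply pullback.hom_ext
      · simp [r, u₂, hl1, ← reassoc_of% hv1]
      · simp [r, u₂, reassoc_of% hl2, hj2]
    rw [reassoc_of% e1, reassoc_of% e2, ← ho]
    simp only [Category.assoc]
    rw [equalizer.condition])
  have := (hc.regEpi hF hP).epi'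
  refine ⟨W, hW, w1 ≫ w0, s, ?_, ?_⟩
  · rw [← cancel_epi (c (w1 ≫ w0)), reassoc_of% hs, hs0']
    simp [r, c]
  · intro W' hW' w' s' hs'
    obtain ⟨α₀, hα₀, H₀⟩ := U0 hW' w' (pullback.lift (c w' ≫ s') (pullback.snd _ _) (by
      simp [hs', c])) (by simp)
    obtain ⟨α, hα, -⟩ := U1 hW' α₀ (equalizer.lift (pullback.snd _ _) (by
      refine hom_ext_P hP fun T hT t => ?_
      have hcond : t ≫ pullback.fst α₀ (x ≫ pullback.fst _ _) ≫ α₀ =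
          t ≫ pullback.snd _ _ ≫ x ≫ pullback.fst _ _ :=
        congrArg (t ≫ ·) (pullback.condition (f := α₀) (g := x ≫ pullback.fst _ _))
      have hcx := pullback.condition (f := w0) (g := n ≫ pullback.fst ρ ρ ≫ ρ ≫ k)
      have K1 := H₀ hT (pullback.lift (t ≫ pullback.fst _ _)
        (t ≫ pullback.snd _ _ ≫ x ≫ pullback.snd _ _ ≫ n ≫ pullback.fst ρ ρ) (by
          simp only [Category.assoc]
          rw [← hcx, ← hα₀, reassoc_of% hcond])) (t ≫ pullback.snd _ _ ≫ u₁)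
          (by simp [u₁, hcond]) (by simp [u₁])
      have K2 := H₀ hT (pullback.lift (t ≫ pullback.fst _ _)
        (t ≫ pullback.snd _ _ ≫ x ≫ pullback.snd _ _ ≫ n ≫ pullback.snd ρ ρ) (by
          simp only [Category.assoc]
          rw [← pullback.condition_assoc, ← hcx, ← hα₀, reassoc_of% hcond]))
          (t ≫ pullback.snd _ _ ≫ u₂)
          (by simp [u₂, hcond]) (by simp [u₂])
      have L1 := congrArg (· ≫ pullback.fst _ _) K1
      have L2 := congrArg (· ≫ pullback.fst _ _) K2
      simp only [Category.assoc, pullback.lift_fst] at L1 L2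
      rw [← L1, ← L2]
      refine (Category.assoc _ _ _).symm.trans (Eq.trans (congrArg (· ≫ s') ?_) (Category.assoc _ _ _))
      apply pullback.hom_ext
      · simp [c]
      · simp [c, pullback.condition])) (by simp)
    refine ⟨α, by rw [← hα₀, ← hα, Category.assoc], ?_⟩
    intro T hT z z' hz1 hz2
    obtain ⟨j, hj⟩ := hρ.pSurj hP hT (z ≫ pullback.snd _ _)
    have cz := congrArg (z ≫ ·) (pullback.condition (f := w') (g := k))
    have cz' := congrArg (z' ≫ ·) (pullback.condition (f := w1 ≫ w0) (g := k))
    let y : T ⟶ pullback w' (ρ ≫ k) := pullback.lift (z ≫ pullback.fst _ _) j (by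
      rw [reassoc_of% hj]; simpa using cz)
    let y' : T ⟶ pullback (w1 ≫ w0) (ρ ≫ k) := pullback.lift (z' ≫ pullback.fst _ _) j (by
      rw [reassoc_of% hj, ← reassoc_of% hz2]; simpa using cz')
    have ey : z = y ≫ c w' := by
      apply pullback.hom_ext <;> simp [y, c, hj]
    have ey' : z' = y' ≫ c (w1 ≫ w0) := by
      apply pullback.hom_ext <;> simp [y', c, hj, hz2]
    have K1 := H₀ hT y (y' ≫ r) (by simp [r, y, y', reassoc_of% hz1, hα]) (by simp [r, y, y'])
    have L1 := congrArg (· ≫ pullback.fst _ _) K1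
    simp only [Category.assoc, pullback.lift_fst] at L1
    rw [ey, ey', Category.assoc, Category.assoc, hs, L1]

theorem per_iff {Y1 Y0 : E} (y₁ y₂ : Y1 ⟶ Y0) : IsPseudoEquivRel y₁ y₂ ↔
    ∃ (R : E) (e : Y1 ⟶ R) (r₁ r₂ : R ⟶ Y0), RegEpi e ∧ e ≫ r₁ = y₁ ∧ e ≫ r₂ = y₂ ∧
      IsEquivRelPair r₁ r₂ := by
  constructor
  · rintro ⟨R, e, m, he, hm, hem, hR⟩
    exact ⟨R, e, _, _, he, by simp [← Category.assoc, hem], by simp [← Category.assoc, hem], hR⟩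
  · rintro ⟨R, e, r₁, r₂, he, rfl, rfl, hR⟩
    refine ⟨R, e, prod.lift r₁ r₂, he, ⟨fun a b h => hR.jointlyMono _ _ ?_ ?_⟩, ?_, ?_⟩
    · simpa using congrArg (· ≫ prod.fst) h
    · simpa using congrArg (· ≫ prod.snd) h
    · ext <;> simp
    · simpa using hR

section OverAux

variable {U : E}

theorem regEpi_left {A B : Over U} {f : A ⟶ B} (h : RegEpi f) : RegEpi f.left := by
  obtain ⟨r⟩ := h
  have : PreservesColimitsOfSize.{0, 0} (Over.forget U) :=
    (Over.forgetAdjStar U).leftAdjoint_preservesColimits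
  exact ⟨⟨_, _, _, _, isColimitCoforkMapOfIsColimit (Over.forget U) r.w r.isColimit⟩⟩

theorem regEpi_of_left {A B : Over U} {f : A ⟶ B} (h : RegEpi f.left) : RegEpi f := by
  obtain ⟨r⟩ := h
  have hw : r.right ≫ A.hom = r.left ≫ A.hom := by
    rw [← Over.w f, reassoc_of% r.w]
  let l : Over.mk (r.left ≫ A.hom) ⟶ A := Over.homMk r.left
  let l' : Over.mk (r.left ≫ A.hom) ⟶ A := Over.homMk r.right hw
  have w : l ≫ f = l' ≫ f := by
    ext; exact r.w
  exact ⟨⟨_, l, l', w, isColimitOfIsColimitCoforkMap (Over.forget U) w r.isColimit⟩⟩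

theorem over_factor (hF : FactorP E) : FactorP (Over U) := by
  intro A B f
  obtain ⟨I, e, m, he, hm, h⟩ := hF f.left
  let m' : Over.mk (m ≫ B.hom) ⟶ B := Over.homMk m
  let e' : A ⟶ Over.mk (m ≫ B.hom) := Over.homMk e (by
    simp [reassoc_of% h])
  refine ⟨_, e', m', regEpi_of_left he, ?_, ?_⟩
  · have : Mono m'.left := hm
    exact Over.mono_of_mono_left m'
  · ext; exact h

theorem over_cover {P : Set E} (hP : IsProjectiveCover P) :
    IsProjectiveCover {Z : Over U | Z.left ∈ P} := by
  constructor
  · intro X hX A B e he f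
    obtain ⟨g, hg⟩ := hP.1 _ hX e.left (regEpi_left he) f.left
    exact ⟨Over.homMk g (by rw [← Over.w e, reassoc_of% hg, Over.w f]), by ext; exact hg⟩
  · intro A
    obtain ⟨T, hT, p, hp⟩ := hP.2 A.left
    exact ⟨Over.mk (p ≫ A.hom), hT, Over.homMk p, regEpi_of_left hp⟩

theorem per_left {Y1 Y0 : Over U} {y₁ y₂ : Y1 ⟶ Y0} (h : IsPseudoEquivRel y₁ y₂) :
    IsPseudoEquivRel y₁.left y₂.left := by
  rw [per_iff] at h ⊢
  obtain ⟨R, e, r₁, r₂, he, rfl, rfl, hR⟩ := h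
  refine ⟨R.left, e.left, r₁.left, r₂.left, regEpi_left he, rfl, rfl, ?_, ?_, ?_, ?_⟩
  · intro T h k h1 h2
    have := hR.jointlyMono (T := Over.mk (h ≫ R.hom)) (Over.homMk h) (Over.homMk k (by
      simp only [Over.mk_hom]
      rw [← Over.w r₁, reassoc_of% h1])) (by ext; exact h1) (by ext; exact h2)
    exact congrArg (fun z => z.left) this
  · obtain ⟨d, h1, h2⟩ := hR.refl
    exact ⟨d.left, congrArg (fun z => z.left) h1, congrArg (fun z => z.left) h2⟩
  · obtain ⟨d, h1, h2⟩ := hR.symm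
    exact ⟨d.left, congrArg (fun z => z.left) h1, congrArg (fun z => z.left) h2⟩
  · intro T p q h
    obtain ⟨t, h1, h2⟩ := hR.trans (T := Over.mk (p ≫ R.hom)) (Over.homMk p)
      (Over.homMk q (by
        simp only [Over.mk_hom]
        rw [← Over.w r₁, ← reassoc_of% h, Over.w, Over.w])) (by ext; exact h)
    exact ⟨t.left, congrArg (fun z => z.left) h1, congrArg (fun z => z.left) h2⟩

theorem per_over {Y1 Y0 : Over U} {y₁ y₂ : Y1 ⟶ Y0}
    (h : IsPseudoEquivRel y₁.left y₂.left) : IsPseudoEquivRel y₁ y₂ := by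
  rw [per_iff] at h ⊢
  obtain ⟨R, e, r₁, r₂, he, h1, h2, hR⟩ := h
  have hr : r₂ ≫ Y0.hom = r₁ ≫ Y0.hom := by
    have := he.epi'
    rw [← cancel_epi e, reassoc_of% h1, reassoc_of% h2, Over.w, Over.w]
  refine ⟨Over.mk (r₁ ≫ Y0.hom), Over.homMk e (by simp [reassoc_of% h1]), Over.homMk r₁,
    Over.homMk r₂ hr, regEpi_of_left he, by ext; exact h1, by ext; exact h2, ?_, ?_, ?_, ?_⟩
  · intro T h k h1 h2
    ext
    exact hR.jointlyMono _ _ (congrArg (fun z => z.left) h1) (congrArg (fun z => z.left) h2)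
  · obtain ⟨d, h1, h2⟩ := hR.refl
    exact ⟨Over.homMk d (by simp [reassoc_of% h1]), by ext; exact h1, by ext; exact h2⟩
  · obtain ⟨d, h1, h2⟩ := hR.symm
    exact ⟨Over.homMk d (by simp [reassoc_of% h1, hr]), by ext; exact h1, by ext; exact h2⟩
  · intro T p q h
    obtain ⟨t, h1, h2⟩ := hR.trans p.left q.left (congrArg (fun z => z.left) h)
    exact ⟨Over.homMk t (by
      have := Over.w p
      simp only [Over.mk_hom] at this ⊢
      rw [reassoc_of% h1, this]), by ext; exact h1, by ext; exact h2⟩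

end OverAux

theorem gwdp_of_gwsp (hE : IsExact E) (P : Set E) (hP : IsProjectiveCover P)
    (H : ∀ U ∈ P, HasGWSP {Z : Over U | Z.left ∈ P}) : HasGWDP P := by
  have hF : FactorP E := hE.factor
  intro Y1 Y0 X J hY1 hY0 hX hJ y₁ y₂ hy g f hg
  let OY1 : Over J := Over.mk (y₁ ≫ g ≫ f)
  let OY0 : Over J := Over.mk (g ≫ f)
  let OX : Over J := Over.mk f
  let OJ : Over J := Over.mk (𝟙 J)
  let oy₁ : OY1 ⟶ OY0 := Over.homMk y₁
  let oy₂ : OY1 ⟶ OY0 := Over.homMk y₂ (by simp [OY0, OY1, reassoc_of% hg])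
  let of : OY0 ⟶ OJ := Over.homMk (g ≫ f) (by simp [OY0, OJ])
  let og : OY0 ⟶ OX := Over.homMk g
  obtain ⟨W, V, w, p, q, e, hD⟩ := H J hJ (Y1 := OY1) (Y0 := OY0) (J := OJ) (X := OX)
    hY1 hY0 hJ hX oy₁ oy₂ (per_over hy) of og (by ext; simp [oy₁, oy₂, of, reassoc_of% hg])
    (by ext; exact hg)
  have hpres := (presWP_iff (over_factor hF) (over_cover hP) hD.cone.wp _ _ _).1 hD.cone.pres
  have hq : e.left ≫ g = q.left := (congrArg (fun z => z.left) hD.cone.comm₂).symm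
  have hqf : q.left ≫ f = V.hom := Over.w q
  have hcomm : q.left ≫ f = p.left ≫ W.hom := by rw [hqf, Over.w p]
  have hwpb : IsWeakPullback P f W.hom q.left p.left := by
    refine ⟨hD.cone.wp.mem, hcomm, ?_⟩
    intro T hT a b hab
    obtain ⟨k, h1, h2⟩ := hD.cone.wp.lift (V' := Over.mk (b ≫ W.hom)) hT
      (Over.homMk b) (Over.homMk a hab)
    exact ⟨k.left, congrArg (fun z => z.left) h2, congrArg (fun z => z.left) h1⟩
  refine ⟨W.left, V.left, W.hom, q.left, p.left, e.left,
    ⟨hD.cone.memW, hcomm, hwpb, hq, ?_⟩, ?_⟩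
  · rw [presWPB_iff hF hP hwpb]
    intro T hT v₁ v₂ h1 h2
    obtain ⟨t, k1, k2⟩ := hpres (T := Over.mk (v₁ ≫ V.hom)) hT (Over.homMk v₁)
      (Over.homMk v₂ (by
        simp only [Over.mk_hom]; rw [← Over.w p, reassoc_of% h2]))
      (by ext; exact h2) (by ext; exact h1)
    exact ⟨t.left, congrArg (fun z => z.left) k1, congrArg (fun z => z.left) k2⟩
  · intro W' V' w' a' b' e' hC
    have hov := hC.overX
    have hcm := hC.comm
    have hpr := (presWPB_iff hF hP hC.wpb hC.comm _ _ _).1 hC.pres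
    let OW : Over J := Over.mk w'
    let OV : Over J := Over.mk (b' ≫ w')
    let op : OV ⟶ OW := Over.homMk b'
    let oq : OV ⟶ OX := Over.homMk a' hcm
    let oe : OV ⟶ OY0 := Over.homMk e' (by
      simp only [OY0, OV, Over.mk_hom]; rw [reassoc_of% hov, hcm])
    have hwp : IsWeakProduct {Z : Over J | Z.left ∈ P} op oq := by
      refine ⟨hC.wpb.mem, ?_⟩
      intro T hT p' q'
      have hp' : p'.left ≫ w' = T.hom := Over.w p'
      obtain ⟨k, h1, h2⟩ := hC.wpb.lift hT q'.left p'.left (by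
        rw [hp']; exact Over.w q')
      exact ⟨Over.homMk k (by simp only [OV, Over.mk_hom]; rw [reassoc_of% h2, hp']),
        by ext; exact h2, by ext; exact h1⟩
    obtain ⟨α, β, h1, h2, h3, h4⟩ := hD.lift (W' := OW) (V' := OV)
      (Over.homMk w' (by simp [OJ, OW])) op oq oe ⟨hC.memW, hwp, by
        rw [presWP_iff (over_factor hF) (over_cover hP) hwp]
        intro T hT v₁ v₂ h1 h2
        obtain ⟨t, k1, k2⟩ := hpr hT v₁.left v₂.left (congrArg (fun z => z.left) h2)
          (congrArg (fun z => z.left) h1)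
        exact ⟨Over.homMk t (by
          have hh : (v₁ ≫ oe).left ≫ g ≫ f = T.hom := Over.w (v₁ ≫ oe)
          have k1' : t ≫ y₁ = (v₁ ≫ oe).left := k1
          simp only [OY1, Over.mk_hom]
          rw [reassoc_of% k1', hh]), by ext; exact k1, by ext; exact k2⟩, by
        ext
        change b' ≫ w' = e' ≫ g ≫ f
        rw [reassoc_of% hov, hcm], by
        ext; exact hov.symm⟩
    exact ⟨α.left, β.left, Over.w α, congrArg (fun z => z.left) h3,
      congrArg (fun z => z.left) h2, congrArg (fun z => z.left) h4⟩

theorem gwsp_of_gwdp (hE : IsExact E) (P : Set E) (hP : IsProjectiveCover P)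
    (H : HasGWDP P) (U : E) : HasGWSP {Z : Over U | Z.left ∈ P} := by
  have hF : FactorP E := hE.factor
  intro Y1 Y0 J X hY1 hY0 hJ hX y₁ y₂ hy f g hf hg
  have hf' : y₁.left ≫ f.left = y₂.left ≫ f.left := congrArg (fun z => z.left) hf
  have hg' : y₁.left ≫ g.left = y₂.left ≫ g.left := congrArg (fun z => z.left) hg
  obtain ⟨B, π, hπ, hyπ, hker⟩ := per_quotient hE hP _ _ (per_left hy)
  obtain ⟨h, hh⟩ := hπ.descend hP (pullback.lift (f := J.hom) (g := X.hom) f.left g.left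
    (by rw [Over.w, Over.w])) (by
      intro T hT v₁ v₂ hv
      obtain ⟨t, rfl, rfl⟩ := hker hT v₁ v₂ hv
      apply pullback.hom_ext <;> simp [hf', hg'])
  have hh1 : π ≫ h ≫ pullback.fst _ _ = f.left := by simp [reassoc_of% hh]
  have hh2 : π ≫ h ≫ pullback.snd _ _ = g.left := by simp [reassoc_of% hh]
  obtain ⟨W, hW, w, s, hs, UP⟩ := quasiB hF hP H hJ h (pullback.fst J.hom X.hom)
  obtain ⟨V, hV, c, hc⟩ := hP.2 (pullback s π)
  have hcw : pullback.fst w (pullback.fst J.hom X.hom) ≫ w =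
    pullback.snd _ _ ≫ pullback.fst J.hom X.hom := pullback.condition
  have hJX : pullback.fst J.hom X.hom ≫ J.hom = pullback.snd _ _ ≫ X.hom := pullback.condition
  have hsp : pullback.fst s π ≫ s = pullback.snd _ _ ≫ π := pullback.condition
  have hef : c ≫ pullback.snd s π ≫ f.left = c ≫ pullback.fst s π ≫ pullback.fst _ _ ≫ w := by
    rw [hcw, ← hs, ← hh1]; simp only [Category.assoc]; rw [reassoc_of% hsp]
  have heg : c ≫ pullback.snd s π ≫ g.left =
      c ≫ pullback.fst s π ≫ pullback.snd _ _ ≫ pullback.snd _ _ := by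
    rw [← hh2, ← reassoc_of% hs, reassoc_of% hsp]
  have hfw : f.left ≫ J.hom = Y0.hom := Over.w f
  have hgw : g.left ≫ X.hom = Y0.hom := Over.w g
  let OW : Over U := Over.mk (w ≫ J.hom)
  let OV : Over U := Over.mk (c ≫ pullback.snd s π ≫ Y0.hom)
  let ow : OW ⟶ J := Over.homMk w
  let op : OV ⟶ OW := Over.homMk (c ≫ pullback.fst s π ≫ pullback.fst _ _) (by
    simp only [OV, OW, Over.mk_hom, Category.assoc]
    rw [← hfw, reassoc_of% hef])
  let oq : OV ⟶ X := Over.homMk (c ≫ pullback.fst s π ≫ pullback.snd _ _ ≫ pullback.snd _ _) (by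
    simp only [OV, Over.mk_hom, Category.assoc]
    rw [← hgw, reassoc_of% heg])
  let oe : OV ⟶ Y0 := Over.homMk (c ≫ pullback.snd s π) (by simp [OV])
  have hwp : IsWeakProduct {Z : Over U | Z.left ∈ P} op oq := by
    refine ⟨hV, ?_⟩
    intro T hT p' q'
    have hp' : p'.left ≫ w ≫ J.hom = T.hom := Over.w p'
    have hq' : q'.left ≫ X.hom = T.hom := Over.w q'
    let z : T.left ⟶ pullback w (pullback.fst J.hom X.hom) :=
      pullback.lift p'.left (pullback.lift (p'.left ≫ w) q'.left (by
        rw [Category.assoc, hp', hq'])) (by simp)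
    obtain ⟨j, hj⟩ := hπ.pSurj hP hT (z ≫ s)
    obtain ⟨k, hk⟩ := hc.pSurj hP hT (pullback.lift z j hj.symm)
    have k1 : k ≫ c ≫ pullback.fst s π ≫ pullback.fst _ _ = p'.left := by
      rw [reassoc_of% hk]; simp [z]
    have k2 : k ≫ c ≫ pullback.fst s π ≫ pullback.snd _ _ ≫ pullback.snd _ _ = q'.left := by
      rw [reassoc_of% hk]; simp [z]
    refine ⟨Over.homMk k ?_, by ext; exact k1, by ext; exact k2⟩
    simp only [OV, Over.mk_hom]
    rw [← hfw, reassoc_of% hef, reassoc_of% k1, hp']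
  refine ⟨OW, OV, ow, op, oq, oe, ⟨hW, hwp, ?_, ?_, ?_⟩, ?_⟩
  · rw [presWP_iff (over_factor hF) (over_cover hP) hwp]
    intro T hT v₁ v₂ h1 h2
    have h1' : v₁.left ≫ c ≫ pullback.fst s π ≫ pullback.fst _ _ =
      v₂.left ≫ c ≫ pullback.fst s π ≫ pullback.fst _ _ := congrArg (fun z => z.left) h1
    have h2' : v₁.left ≫ c ≫ pullback.fst s π ≫ pullback.snd _ _ ≫ pullback.snd _ _ =
      v₂.left ≫ c ≫ pullback.fst s π ≫ pullback.snd _ _ ≫ pullback.snd _ _ :=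
      congrArg (fun z => z.left) h2
    have h3 : v₁.left ≫ c ≫ pullback.fst s π = v₂.left ≫ c ≫ pullback.fst s π := by
      apply pullback.hom_ext
      · simpa using h1'
      · apply pullback.hom_ext
        · simp only [Category.assoc]
          rw [← hcw, reassoc_of% h1']
        · simpa using h2'
    obtain ⟨t, k1, k2⟩ := hker hT (v₁.left ≫ c ≫ pullback.snd s π)
      (v₂.left ≫ c ≫ pullback.snd s π) (by
        simp only [Category.assoc]
        rw [← hsp, reassoc_of% h3])
    refine ⟨Over.homMk t ?_, by ext; exact k1, by ext; exact k2⟩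
    have hv : v₁.left ≫ c ≫ pullback.snd s π ≫ Y0.hom = T.hom := Over.w v₁
    rw [← Over.w y₁, reassoc_of% k1, hv]
  · ext
    change (c ≫ pullback.fst s π ≫ pullback.fst _ _) ≫ w = (c ≫ pullback.snd s π) ≫ f.left
    simp [hef]
  · ext
    change _ = (c ≫ pullback.snd s π) ≫ g.left
    simp [heg, oq]
  · intro W' V' w' p' q' e' hC
    have hpr := (presWP_iff (over_factor hF) (over_cover hP) hC.wp _ _ _).1 hC.pres
    have c1 : p'.left ≫ w'.left = e'.left ≫ f.left := congrArg (fun z => z.left) hC.comm₁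
    have c2 : q'.left = e'.left ≫ g.left := congrArg (fun z => z.left) hC.comm₂
    let c' : V'.left ⟶ pullback w'.left (pullback.fst J.hom X.hom) :=
      pullback.lift p'.left (pullback.lift (p'.left ≫ w'.left) q'.left (by simp)) (by simp)
    have hc' : PSurj P c' := by
      intro T hT t
      have ht : t ≫ pullback.snd _ _ ≫ pullback.snd _ _ ≫ X.hom =
          t ≫ pullback.fst _ _ ≫ W'.hom := by
        rw [← hJX, ← pullback.condition_assoc, Over.w w']
      obtain ⟨k, h1, h2⟩ := hC.wp.lift (V' := Over.mk (t ≫ pullback.fst _ _ ≫ W'.hom)) hT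
        (Over.homMk (t ≫ pullback.fst _ _))
        (Over.homMk (t ≫ pullback.snd _ _ ≫ pullback.snd _ _) (by simpa using ht))
      have h1' : k.left ≫ p'.left = t ≫ pullback.fst _ _ := congrArg (fun z => z.left) h1
      have h2' : k.left ≫ q'.left = t ≫ pullback.snd _ _ ≫ pullback.snd _ _ :=
        congrArg (fun z => z.left) h2
      refine ⟨k.left, ?_⟩
      apply pullback.hom_ext
      · simpa [c'] using h1'
      · apply pullback.hom_ext
        · simp [c', reassoc_of% h1', pullback.condition]
        · simpa [c'] using h2'
    obtain ⟨s', hs'⟩ := hc'.descend hF hP (e'.left ≫ π) (by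
      intro T hT v₁ v₂ hv
      have h1 : v₁ ≫ p'.left = v₂ ≫ p'.left := by
        simpa [c'] using congrArg (· ≫ pullback.fst _ _) hv
      have h2 : v₁ ≫ q'.left = v₂ ≫ q'.left := by
        simpa [c'] using congrArg (· ≫ pullback.snd _ _ ≫ pullback.snd _ _) hv
      obtain ⟨t, k1, k2⟩ := hpr (T := Over.mk (v₁ ≫ V'.hom)) hT (Over.homMk v₁)
        (Over.homMk v₂ (by
          simp only [Over.mk_hom]; rw [← Over.w p', reassoc_of% h1]))
        (by ext; exact h1) (by ext; exact h2)
      have k1' : t.left ≫ y₁.left = v₁ ≫ e'.left := congrArg (fun z => z.left) k1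
      have k2' : t.left ≫ y₂.left = v₂ ≫ e'.left := congrArg (fun z => z.left) k2
      rw [← reassoc_of% k1', ← reassoc_of% k2', hyπ])
    have := (hc'.regEpi hF hP).epi'
    obtain ⟨α, hα, hU⟩ := UP hC.memW w'.left s' (by
      rw [← cancel_epi c', reassoc_of% hs', hh]
      apply pullback.hom_ext
      · simp [c', c1]
      · simp [c', c2])
    let z' : V'.left ⟶ pullback w (pullback.fst J.hom X.hom) :=
      pullback.lift (p'.left ≫ α) (c' ≫ pullback.snd _ _) (by simp [c', hα])
    have hz := hU hC.wp.mem c' z' (by simp [z', c']) (by simp [z'])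
    obtain ⟨β, hβ⟩ := hc.pSurj hP hC.wp.mem (pullback.lift z' e'.left (by rw [← hz, hs']))
    have b1 : β ≫ c ≫ pullback.snd s π = e'.left := by rw [reassoc_of% hβ]; simp
    refine ⟨Over.homMk α ?_, Over.homMk β ?_, ?_, ?_, ?_, ?_⟩
    · simp only [OW, Over.mk_hom]
      rw [reassoc_of% hα, Over.w]
    · simp only [OV, Over.mk_hom]
      rw [reassoc_of% b1, Over.w]
    · ext; exact hα
    · ext
      change β ≫ c ≫ pullback.fst s π ≫ pullback.fst _ _ = p'.left ≫ α
      rw [reassoc_of% hβ]; simp [z']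
    · ext
      change β ≫ c ≫ pullback.fst s π ≫ pullback.snd _ _ ≫ pullback.snd _ _ = q'.left
      rw [reassoc_of% hβ]; simp [z', c']
    · ext; exact b1

end Aux

/-- `P` has generalised weak dependent products iff for every `U ∈ P`
the slice `P/U` (a projective cover of `E/U`) has generalised weak simple products. -/
theorem stmt17 {E : Type u} [Category.{v} E] [HasFiniteLimits E]
    (hE : IsExact E) (P : Set E) (hP : IsProjectiveCover P) :
    HasGWDP P ↔
      ∀ U ∈ P, HasGWSP {Z : Over U | Z.left ∈ P} := by
  exact ⟨fun H U _ => gwsp_of_gwdp hE P hP H U, gwdp_of_gwsp hE P hP⟩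

end ExComp
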